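/- Let n ≥ 1, a = (a₁,…,aₙ) ∈ [1,∞)ⁿ, ρ > 0 and let k ∈ ℕ₀ be the integer with k < ρ ≤ k + 1. Let u : ℝⁿ → ℂ be a C^k function with finite Hölder norm ‖u‖_ρ := Σ_{|α|≤k} sup_x |∂^α u(x)| + Σ_{|α|=k} sup_{x≠y} |∂^α u(x) − ∂^α u(y)|·|x−y|^{k−ρ}, and let φ ∈ 𝒮(ℝⁿ) satisfy ∫ φ(y) y^α dy = 0 for all multi-indices α with |α| ≤ k. Then there is a constant c > 0, depending only on n, k and ρ, such that for all j ∈ ℕ₀ and all x ∈ ℝⁿ: |∫_{ℝⁿ} φ(y) u(x − 2^{-ja}y) dy| ≤ c · 2^{-jρ} · ‖u‖_ρ · ∫ |φ(y)| |y|^ρ dy, where 2^{-ja}y := (2^{-ja₁}y₁,…,2^{-jaₙ}yₙ). -/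

import Mathlib

open MeasureTheory

/-- The partial derivative `∂_i f` of a function on `ℝⁿ`. -/
noncomputable def pd {n : ℕ} {E : Type*} [NormedAddCommGroup E] [NormedSpace ℝ E]
    (i : Fin n) (f : (Fin n → ℝ) → E) : (Fin n → ℝ) → E :=
  fun x => fderiv ℝ f x (Pi.single i 1)

/-- The multi-index partial derivative `∂^α f = ∂₁^{α₁} ⋯ ∂ₙ^{αₙ} f`. -/
noncomputable def mderiv {n : ℕ} {E : Type*} [NormedAddCommGroup E] [NormedSpace ℝ E]
    (α : Fin n → ℕ) (f : (Fin n → ℝ) → E) : (Fin n → ℝ) → E :=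
  (List.finRange n).foldr (fun i g => (pd i)^[α i] g) f

section PartialDerivatives

variable {n : ℕ} {E : Type*} [NormedAddCommGroup E] [NormedSpace ℝ E]

lemma mderiv_zero (f : (Fin n → ℝ) → E) : mderiv 0 f = f := by
  simp [mderiv]

lemma contDiff_pd {m : ℕ} {f : (Fin n → ℝ) → E} (i : Fin n)
    (hf : ContDiff ℝ ((m + 1 : ℕ) : WithTop ℕ∞) f) : ContDiff ℝ (m : WithTop ℕ∞) (pd i f) := by
  have h : ContDiff ℝ (m : WithTop ℕ∞) (fderiv ℝ f) := hf.fderiv_right (by norm_cast)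
  exact h.clm_apply contDiff_const

lemma pd_comm {f : (Fin n → ℝ) → E} (hf : ContDiff ℝ 2 f) (i j : Fin n) :
    pd i (pd j f) = pd j (pd i f) := by
  funext x
  have hd : DifferentiableAt ℝ (fderiv ℝ f) x :=
    (hf.fderiv_right (m := 1) (by norm_num)).differentiable (by norm_num) x
  have key (v w : Fin n → ℝ) :
      fderiv ℝ (fun y => fderiv ℝ f y v) x w = fderiv ℝ (fderiv ℝ f) x w v := by
    rw [fderiv_clm_apply hd (differentiableAt_const v)]
    simp
  have hs : IsSymmSndFDerivAt ℝ f x := hf.contDiffAt.isSymmSndFDerivAt (by simp)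
  unfold pd
  rw [key, key]
  exact hs _ _

lemma contDiff_iterate_pd {m a : ℕ} {f : (Fin n → ℝ) → E} (i : Fin n)
    (hf : ContDiff ℝ ((m + a : ℕ) : WithTop ℕ∞) f) :
    ContDiff ℝ (m : WithTop ℕ∞) ((pd i)^[a] f) := by
  induction a generalizing f with
  | zero => exact hf
  | succ a ih => exact ih (contDiff_pd i hf)

lemma iterate_pd_pd {a : ℕ} {f : (Fin n → ℝ) → E} (i l : Fin n)
    (hf : ContDiff ℝ ((1 + a : ℕ) : WithTop ℕ∞) f) :
    (pd l)^[a] (pd i f) = pd i ((pd l)^[a] f) := by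
  induction a with
  | zero => rfl
  | succ a ih =>
    rw [Function.iterate_succ_apply', Function.iterate_succ_apply',
      ih (hf.of_le (by norm_cast; omega))]
    refine pd_comm ?_ l i
    have h : ContDiff ℝ ((2 + a : ℕ) : WithTop ℕ∞) f := hf.of_le (by norm_cast; omega)
    exact contDiff_iterate_pd l h

/-- Mixed partial derivative in the directions of the list `L`, with orders given by `α`. -/
noncomputable def mderivList (L : List (Fin n)) (α : Fin n → ℕ) (f : (Fin n → ℝ) → E) :
    (Fin n → ℝ) → E :=
  L.foldr (fun i g => (pd i)^[α i] g) f

lemma contDiff_mderivList {m : ℕ} (L : List (Fin n)) {α : Fin n → ℕ} {f : (Fin n → ℝ) → E}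
    (hf : ContDiff ℝ ((m + (L.map α).sum : ℕ) : WithTop ℕ∞) f) :
    ContDiff ℝ (m : WithTop ℕ∞) (mderivList L α f) := by
  induction L generalizing m with
  | nil => exact hf
  | cons l L ih =>
    have h := ih (m := m + α l)
      (hf.of_le (by simp only [List.map_cons, List.sum_cons]; norm_cast; omega))
    exact contDiff_iterate_pd l h

lemma mderivList_pd (L : List (Fin n)) {α : Fin n → ℕ} {f : (Fin n → ℝ) → E} (i : Fin n)
    (hf : ContDiff ℝ ((1 + (L.map α).sum : ℕ) : WithTop ℕ∞) f) :
    mderivList L α (pd i f) = pd i (mderivList L α f) := by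
  induction L with
  | nil => rfl
  | cons l L ih =>
    have h : ContDiff ℝ (((1 + α l) + (L.map α).sum : ℕ) : WithTop ℕ∞) f :=
      hf.of_le (by simp only [List.map_cons, List.sum_cons]; norm_cast; omega)
    change (pd l)^[α l] (mderivList L α (pd i f)) = pd i ((pd l)^[α l] (mderivList L α f))
    rw [ih (h.of_le (by norm_cast; omega)), iterate_pd_pd i l (contDiff_mderivList L h)]

lemma mderivList_congr (L : List (Fin n)) {α β : Fin n → ℕ} (f : (Fin n → ℝ) → E)
    (h : ∀ i ∈ L, α i = β i) : mderivList L α f = mderivList L β f := by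
  induction L with
  | nil => rfl
  | cons l L ih =>
    change (pd l)^[α l] (mderivList L α f) = (pd l)^[β l] (mderivList L β f)
    rw [ih fun i hi => h i (List.mem_cons_of_mem _ hi), h l List.mem_cons_self]

lemma mderivList_add_single (L : List (Fin n)) (hL : L.Nodup) {α : Fin n → ℕ}
    {f : (Fin n → ℝ) → E} {i : Fin n} (hi : i ∈ L)
    (hf : ContDiff ℝ ((1 + (L.map α).sum : ℕ) : WithTop ℕ∞) f) :
    mderivList L (α + Pi.single i 1) f = mderivList L α (pd i f) := by
  induction L with
  | nil => simp at hi
  | cons l L ih =>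
    have h : ContDiff ℝ ((1 + (L.map α).sum : ℕ) : WithTop ℕ∞) f :=
      hf.of_le (by simp only [List.map_cons, List.sum_cons]; norm_cast; omega)
    change (pd l)^[(α + (Pi.single i 1 : Fin n → ℕ)) l] (mderivList L (α + Pi.single i 1) f) =
      (pd l)^[α l] (mderivList L α (pd i f))
    obtain ⟨hl, hL⟩ := List.nodup_cons.1 hL
    rcases eq_or_ne l i with rfl | hli
    · have hc : mderivList L (α + Pi.single l 1) f = mderivList L α f := by
        refine mderivList_congr L f fun m hm => ?_
        have : m ≠ l := fun e => hl (e ▸ hm)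
        simp [this]
      rw [hc, mderivList_pd L l h]
      simp [Function.iterate_succ_apply]
    · rw [ih hL ((List.mem_cons.1 hi).resolve_left hli.symm) h]
      simp [hli]

lemma mderiv_pd {k : ℕ} {α : Fin n → ℕ} {f : (Fin n → ℝ) → E} (i : Fin n)
    (hα : ∑ i, α i = k) (hf : ContDiff ℝ ((k + 1 : ℕ) : WithTop ℕ∞) f) :
    mderiv α (pd i f) = mderiv (α + Pi.single i 1) f := by
  refine (mderivList_add_single (List.finRange n) (List.nodup_finRange n)
    (List.mem_finRange i) ?_).symm
  have : ((List.finRange n).map α).sum = k := by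
    rw [← hα, ← List.ofFn_eq_map, List.sum_ofFn]
  rw [this, add_comm]
  exact hf

end PartialDerivatives

section Taylor

variable {n : ℕ}

/-- Complex polynomial functions on `ℝⁿ` of degree at most `k`. -/
noncomputable def polyFun (n k : ℕ) : Submodule ℂ ((Fin n → ℝ) → ℂ) :=
  Submodule.span ℂ {q | ∃ α : Fin n → ℕ, ∑ i, α i ≤ k ∧ q = fun y => ∏ i, (y i : ℂ) ^ α i}

lemma const_mem_polyFun (k : ℕ) (z : ℂ) : (fun _ => z) ∈ polyFun n k := by
  have h : (fun _ : Fin n → ℝ => (1 : ℂ)) ∈ polyFun n k :=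
    Submodule.subset_span ⟨0, by simp, by simp⟩
  simpa [Pi.smul_def] using (polyFun n k).smul_mem z h

/-- A radial primitive of `h ↦ h i * q h`. -/
lemma exists_radial_primitive {k : ℕ} (i : Fin n) {q : (Fin n → ℝ) → ℂ} (hq : q ∈ polyFun n k) :
    ∃ Q ∈ polyFun n (k + 1), ∀ (h : Fin n → ℝ) (t : ℝ),
      HasDerivAt (fun s : ℝ => Q (s • h)) ((h i : ℂ) * q (t • h)) t := by
  induction hq using Submodule.span_induction with
  | mem q hq =>
    obtain ⟨α, hα, rfl⟩ := hq
    set m := ∑ i, α i with hm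
    refine ⟨((m : ℂ) + 1)⁻¹ • fun y => ∏ l, (y l : ℂ) ^ (α + (Pi.single i 1 : Fin n → ℕ)) l,
      Submodule.smul_mem _ _ (Submodule.subset_span ⟨_, ?_, rfl⟩), fun h t => ?_⟩
    · simp only [Pi.add_apply, Finset.sum_add_distrib, Finset.sum_pi_single']
      simpa using hα
    have e1 (s : ℝ) : ∏ l, (((s • h) l : ℝ) : ℂ) ^ (α + (Pi.single i 1 : Fin n → ℕ)) l =
        (s : ℂ) ^ (m + 1) * ((h i : ℂ) * ∏ l, (h l : ℂ) ^ α l) := by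
      have : ∏ l, (((s • h) l : ℝ) : ℂ) ^ (Pi.single i 1 : Fin n → ℕ) l = (s : ℂ) * h i := by
        rw [Finset.prod_eq_single i] <;> simp +contextual
      simp only [Pi.add_apply, pow_add, Finset.prod_mul_distrib] at this ⊢
      rw [this]
      simp only [Pi.smul_apply, smul_eq_mul, Complex.ofReal_mul, mul_pow, Finset.prod_mul_distrib,
        Finset.prod_pow_eq_pow_sum, ← hm]
      ring
    have e2 : ∏ l, (((t • h) l : ℝ) : ℂ) ^ α l = (t : ℂ) ^ m * ∏ l, (h l : ℂ) ^ α l := by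
      simp only [Pi.smul_apply, smul_eq_mul, Complex.ofReal_mul, mul_pow, Finset.prod_mul_distrib,
        Finset.prod_pow_eq_pow_sum, ← hm]
    have hd := (((hasDerivAt_id t).ofReal_comp.pow (m + 1)).mul_const
      ((h i : ℂ) * ∏ l, (h l : ℂ) ^ α l)).const_mul ((m : ℂ) + 1)⁻¹
    have hm0 : (m : ℂ) + 1 ≠ 0 := by exact_mod_cast m.succ_ne_zero
    refine (hd.congr_of_eventuallyEq (.of_forall fun s => ?_)).congr_deriv ?_
    · simp only [Pi.smul_apply, smul_eq_mul] at e1 ⊢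
      rw [e1]
      rfl
    · simp only
      rw [e2]
      simp
      field_simp
  | zero => exact ⟨0, zero_mem _, fun h t => by simpa using hasDerivAt_const t (0 : ℂ)⟩
  | add p q _ _ hp hq =>
    obtain ⟨P, hP, hP'⟩ := hp
    obtain ⟨Q, hQ, hQ'⟩ := hq
    refine ⟨P + Q, add_mem hP hQ, fun h t => ?_⟩
    simpa [mul_add] using (hP' h t).fun_add (hQ' h t)
  | smul z q _ hq =>
    obtain ⟨Q, hQ, hQ'⟩ := hq
    exact ⟨z • Q, Submodule.smul_mem _ z hQ, fun h t => by
      simpa [mul_left_comm] using (hQ' h t).const_mul z⟩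

/-- Taylor approximation with Hölder remainder. -/
lemma exists_polyFun_norm_sub_le (n k : ℕ) (ρ : ℝ) (hρ : (k : ℝ) < ρ) :
    ∃ C > (0 : ℝ), ∀ (u : (Fin n → ℝ) → ℂ), ContDiff ℝ (k : WithTop ℕ∞) u → ∀ H : ℝ, 0 ≤ H →
      (∀ α : Fin n → ℕ, ∑ i, α i = k → ∀ x y : Fin n → ℝ, x ≠ y →
        ‖mderiv α u x - mderiv α u y‖ ≤ H * ‖x - y‖ ^ (ρ - k)) →
      ∀ x, ∃ p ∈ polyFun n k, ∀ h, ‖u (x + h) - p h‖ ≤ C * H * ‖h‖ ^ ρ := by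
  induction k generalizing ρ with
  | zero =>
    refine ⟨1, one_pos, fun u _ H hH hu x => ⟨fun _ => u x, const_mem_polyFun 0 _, fun h => ?_⟩⟩
    rcases eq_or_ne h 0 with rfl | hh
    · simp only [add_zero, sub_self, norm_zero]
      positivity
    · simpa [mderiv_zero] using hu 0 (by simp) (x + h) x (by simpa using hh)
  | succ k ih =>
    push_cast at hρ
    obtain ⟨C, hC, hT⟩ := ih (ρ - 1) (by linarith)
    refine ⟨(n + 1) * C, by positivity, fun u hu H hH hu' x => ?_⟩
    have hpd (i : Fin n) : ∃ p ∈ polyFun n k, ∀ h, ‖pd i u (x + h) - p h‖ ≤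
        C * H * ‖h‖ ^ (ρ - 1) := by
      refine hT (pd i u) (contDiff_pd i hu) H hH (fun α hα y z hyz => ?_) x
      rw [mderiv_pd i hα hu]
      have := hu' (α + Pi.single i 1) (by simp [Finset.sum_add_distrib, hα]) y z hyz
      rwa [show ρ - 1 - k = ρ - (k + 1 : ℕ) by push_cast; ring]
    choose p hp hpb using hpd
    choose Q hQ hQd using fun i => exists_radial_primitive i (hp i)
    have hS : ∑ i, Q i ∈ polyFun n (k + 1) := Submodule.sum_mem _ fun i _ => hQ i
    set S := ∑ i, Q i with hSdef
    refine ⟨S + fun _ => u x - S 0, add_mem hS (const_mem_polyFun _ _), fun h => ?_⟩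
    have hSd (t : ℝ) : HasDerivAt (fun s : ℝ => S (s • h)) (∑ i, (h i : ℂ) * p i (t • h)) t := by
      simpa [hSdef] using HasDerivAt.fun_sum fun i (_ : i ∈ Finset.univ) => hQd i h t
    have hud (t : ℝ) : HasDerivAt (fun s : ℝ => u (x + s • h))
        (∑ i, (h i : ℂ) * pd i u (x + t • h)) t := by
      have h1 : HasDerivAt (fun s : ℝ => x + s • h) h t := by
        simpa using ((hasDerivAt_id t).smul_const h).const_add x
      have h2 := (hu.differentiable (by simp) (x + t • h)).hasFDerivAt.comp_hasDerivAt t h1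
      refine h2.congr_deriv ?_
      have h3 : h = ∑ i, h i • (Pi.single i 1 : Fin n → ℝ) := by
        simpa using pi_eq_sum_univ' h
      conv_lhs => enter [2]; rw [h3]
      simp [pd]
    have hbound := norm_image_sub_le_of_norm_deriv_le_segment_01'
      (f := fun s : ℝ => u (x + s • h) - S (s • h)) (C := (n + 1) * C * H * ‖h‖ ^ ρ)
      (fun t _ => ((hud t).sub (hSd t)).hasDerivWithinAt) (fun t ht => ?_)
    · simpa [sub_sub, sub_add, add_comm, add_sub] using hbound
    rw [← Finset.sum_sub_distrib]
    have hpow : ‖h‖ * ‖t • h‖ ^ (ρ - 1) ≤ ‖h‖ ^ ρ := by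
      have hk : (0 : ℝ) ≤ k := k.cast_nonneg
      have hle : ‖t • h‖ ≤ ‖h‖ := by
        rw [norm_smul, Real.norm_of_nonneg ht.1]
        exact mul_le_of_le_one_left (norm_nonneg _) ht.2.le
      calc ‖h‖ * ‖t • h‖ ^ (ρ - 1) ≤ ‖h‖ * ‖h‖ ^ (ρ - 1) := by
            gcongr
            linarith
        _ = ‖h‖ ^ ρ := by
            rw [← Real.rpow_one_add' (norm_nonneg _) (by linarith)]
            congr 1
            ring
    calc ‖∑ i, ((h i : ℂ) * pd i u (x + t • h) - (h i : ℂ) * p i (t • h))‖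
        ≤ ∑ _i : Fin n, C * H * ‖h‖ ^ ρ := by
          refine norm_sum_le_of_le _ fun i _ => ?_
          rw [← mul_sub, norm_mul, Complex.norm_real]
          calc ‖h i‖ * ‖pd i u (x + t • h) - p i (t • h)‖
              ≤ ‖h‖ * (C * H * ‖t • h‖ ^ (ρ - 1)) := by
                gcongr
                · exact norm_le_pi_norm h i
                · exact hpb i _
            _ = C * H * (‖h‖ * ‖t • h‖ ^ (ρ - 1)) := by ring
            _ ≤ C * H * ‖h‖ ^ ρ := by gcongr
      _ = n * C * H * ‖h‖ ^ ρ := by simp; ring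
      _ ≤ (n + 1) * C * H * ‖h‖ ^ ρ := by
          gcongr
          linarith

end Taylor

section Moments

variable {n : ℕ}

lemma SchwartzMap.integrable_mul_monomial (φ : SchwartzMap (Fin n → ℝ) ℂ) (α : Fin n → ℕ) :
    Integrable fun y : Fin n → ℝ => φ y * ∏ i, (y i : ℂ) ^ α i := by
  refine (φ.integrable_pow_mul volume (∑ i, α i)).mono'
    (Continuous.aestronglyMeasurable (by fun_prop)) (.of_forall fun y => ?_)
  rw [norm_mul, mul_comm, norm_prod, ← Finset.prod_pow_eq_pow_sum]
  gcongr with i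
  rw [norm_pow, Complex.norm_real]
  gcongr
  exact norm_le_pi_norm y i

lemma SchwartzMap.integrable_norm_mul_rpow (φ : SchwartzMap (Fin n → ℝ) ℂ) {ρ : ℝ} (hρ : 0 ≤ ρ) :
    Integrable fun y : Fin n → ℝ => ‖φ y‖ * ‖y‖ ^ ρ := by
  have hc : Continuous fun y : Fin n → ℝ => ‖φ y‖ * ‖y‖ ^ ρ :=
    φ.continuous.norm.mul (continuous_norm.rpow_const fun _ => Or.inr hρ)
  refine (φ.integrable.norm.add (φ.integrable_pow_mul volume ⌈ρ⌉₊)).mono'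
    hc.aestronglyMeasurable (.of_forall fun y => ?_)
  have h : ‖y‖ ^ ρ ≤ 1 + ‖y‖ ^ ⌈ρ⌉₊ := by
    rcases le_total ‖y‖ 1 with h1 | h1
    · exact (Real.rpow_le_one (norm_nonneg _) h1 hρ).trans (by simp)
    · have := Real.rpow_le_rpow_of_exponent_le h1 (Nat.le_ceil ρ)
      rw [Real.rpow_natCast] at this
      linarith
  rw [Real.norm_of_nonneg (by positivity)]
  calc ‖φ y‖ * ‖y‖ ^ ρ ≤ ‖φ y‖ * (1 + ‖y‖ ^ ⌈ρ⌉₊) := by gcongr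
    _ = ‖φ y‖ + ‖y‖ ^ ⌈ρ⌉₊ * ‖φ y‖ := by ring

/-- Vanishing moments annihilate polynomials in linearly rescaled variables. -/
lemma integral_mul_polyFun_eq_zero {k : ℕ} (φ : SchwartzMap (Fin n → ℝ) ℂ)
    (hφ : ∀ α : Fin n → ℕ, ∑ i, α i ≤ k → ∫ y : Fin n → ℝ, φ y * ∏ i, (y i : ℂ) ^ α i = 0)
    (d : Fin n → ℝ) {p : (Fin n → ℝ) → ℂ} (hp : p ∈ polyFun n k) :
    (Integrable fun y => φ y * p (d * y)) ∧ ∫ y, φ y * p (d * y) = 0 := by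
  induction hp using Submodule.span_induction with
  | mem q hq =>
    obtain ⟨α, hα, rfl⟩ := hq
    have e (y : Fin n → ℝ) : φ y * ∏ i, (((d * y) i : ℝ) : ℂ) ^ α i =
        (∏ i, (d i : ℂ) ^ α i) * (φ y * ∏ i, (y i : ℂ) ^ α i) := by
      simp only [Pi.mul_apply, Complex.ofReal_mul, mul_pow, Finset.prod_mul_distrib]
      ring
    simp only [e]
    exact ⟨(φ.integrable_mul_monomial α).const_mul _, by rw [integral_const_mul, hφ α hα, mul_zero]⟩
  | zero => simp
  | add p q _ _ hp hq =>
    simp only [Pi.add_apply, mul_add]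
    exact ⟨hp.1.add hq.1, by rw [integral_add hp.1 hq.1, hp.2, hq.2, add_zero]⟩
  | smul z q _ hq =>
    simp only [Pi.smul_apply, smul_eq_mul, mul_left_comm _ z]
    exact ⟨hq.1.const_mul z, by rw [integral_const_mul, hq.2, mul_zero]⟩

end Moments


/-- if `u ∈ C^ρ_*` (expressed through a bound `H` for its Hölder norm
pieces: `‖∂^α u‖_∞ ≤ H` for `|α| ≤ k` and the `(ρ−k)`-Hölder constants of `∂^α u`,
`|α| = k`, are `≤ H`), and `φ ∈ 𝒮` has vanishing moments of order `≤ k`, then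
`|∫ φ(y) u(x − 2^{-ja}y) dy| ≤ c·2^{-jρ}·H·∫|φ(y)||y|^ρ dy`, where `c = c(n,k,ρ)`. -/
theorem statement16 {n : ℕ} (hn : 1 ≤ n) (ρ : ℝ) (k : ℕ)
    (hk₁ : (k : ℝ) < ρ) (hk₂ : ρ ≤ k + 1) :
    ∃ c > (0 : ℝ), ∀ a : Fin n → ℝ, (∀ i, 1 ≤ a i) →
      ∀ u : (Fin n → ℝ) → ℂ, ContDiff ℝ (k : ℕ∞) u →
      ∀ H : ℝ,
        (∀ α : Fin n → ℕ, ∑ i, α i ≤ k → ∀ x, ‖mderiv α u x‖ ≤ H) →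
        (∀ α : Fin n → ℕ, ∑ i, α i = k → ∀ x y : Fin n → ℝ, x ≠ y →
          ‖mderiv α u x - mderiv α u y‖ ≤ H * ‖x - y‖ ^ (ρ - k)) →
      ∀ φ : SchwartzMap (Fin n → ℝ) ℂ,
        (∀ α : Fin n → ℕ, ∑ i, α i ≤ k →
          ∫ y : Fin n → ℝ, φ y * ∏ i, (y i : ℂ) ^ α i = 0) →
      ∀ (j : ℕ) (x : Fin n → ℝ),
        ‖∫ y : Fin n → ℝ, φ y * u (fun i => x i - (2 : ℝ) ^ (-(j : ℝ) * a i) * y i)‖ ≤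
          c * (2 : ℝ) ^ (-(j : ℝ) * ρ) * H * ∫ y : Fin n → ℝ, ‖φ y‖ * ‖y‖ ^ ρ := by
  have hk : (0 : ℝ) ≤ k := k.cast_nonneg
  have hρ : 0 < ρ := hk.trans_lt hk₁
  obtain ⟨C, hC, hT⟩ := exists_polyFun_norm_sub_le n k ρ hk₁
  refine ⟨C, hC, fun a ha u hu H hb hh φ hφ j x => ?_⟩
  have huH (y) : ‖u y‖ ≤ H := by simpa [mderiv_zero] using hb 0 (by simp) y
  have hH : 0 ≤ H := (norm_nonneg _).trans (huH 0)
  obtain ⟨p, hp, hpb⟩ := hT u (mod_cast hu) H hH hh x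
  set d : Fin n → ℝ := fun i => -(2 : ℝ) ^ (-(j : ℝ) * a i) with hd
  have hx (y : Fin n → ℝ) : (fun i => x i - (2 : ℝ) ^ (-(j : ℝ) * a i) * y i) = x + d * y := by
    funext i
    simp [hd, sub_eq_add_neg]
  simp only [hx]
  have hdn (y : Fin n → ℝ) : ‖d * y‖ ≤ (2 : ℝ) ^ (-(j : ℝ)) * ‖y‖ := by
    refine (pi_norm_le_iff_of_nonneg (by positivity)).2 fun i => ?_
    rw [Pi.mul_apply, norm_mul]
    refine mul_le_mul ?_ (norm_le_pi_norm y i) (norm_nonneg _) (by positivity)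
    rw [hd, norm_neg, Real.norm_of_nonneg (by positivity)]
    refine Real.rpow_le_rpow_of_exponent_le one_le_two ?_
    nlinarith [ha i, (Nat.cast_nonneg j : (0 : ℝ) ≤ j)]
  obtain ⟨hpi, hp0⟩ := integral_mul_polyFun_eq_zero φ hφ d hp
  have hui : Integrable fun y => φ y * u (x + d * y) :=
    φ.integrable.mul_bdd (c := H) (Continuous.aestronglyMeasurable (hu.continuous.comp (by fun_prop)))
      (.of_forall fun y => huH _)
  rw [← sub_zero (∫ y, φ y * u (x + d * y)), ← hp0, ← integral_sub hui hpi, ← integral_const_mul]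
  refine norm_integral_le_of_norm_le ((φ.integrable_norm_mul_rpow hρ.le).const_mul _)
    (.of_forall fun y => ?_)
  rw [← mul_sub, norm_mul]
  calc ‖φ y‖ * ‖u (x + d * y) - p (d * y)‖
      ≤ ‖φ y‖ * (C * H * ((2 : ℝ) ^ (-(j : ℝ)) * ‖y‖) ^ ρ) := by
        gcongr
        refine (hpb _).trans ?_
        gcongr
        exact hdn y
    _ = C * (2 : ℝ) ^ (-(j : ℝ) * ρ) * H * (‖φ y‖ * ‖y‖ ^ ρ) := by
        rw [Real.mul_rpow (by positivity) (norm_nonneg _), ← Real.rpow_mul two_pos.le]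
        ring
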